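/- arXiv:2605.14324 — 2 statements merged into one kernel-verified Lean document; each statement's English description precedes it below -/
import Mathlib

section
/- Let p ∈ [2,∞) and q ≥ 1. For all x, y ∈ ℝ^q with ‖x‖_p = ‖y‖_p = 1 and all τ ≥ 0, (‖x + τ y‖_p + ‖x − τ y‖_p)/2 − 1 ≤ ((p−1)/2) τ²; that is, the modulus of smoothness of the ℓ_p norm satisfies ρ_p(τ) ≤ ((p−1)/2) τ². -/
/-- The ℓ_p norm on `Fin q → ℝ`. -/
noncomputable def lpNorm (p : ℝ) (q : ℕ) (x : Fin q → ℝ) : ℝ := (∑ i, |x i| ^ p) ^ (1 / p)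

/-- Power-mean inequality between the exponents `p - 2` and `p`. -/
lemma rpow_sub_two_mean_le {p : ℝ} (hp : 2 ≤ p) {a b : ℝ} (ha : 0 ≤ a) (hb : 0 ≤ b) :
    (a ^ (p - 2) + b ^ (p - 2)) / 2 ≤ ((a ^ p + b ^ p) / 2) ^ (1 - 2 / p) := by
  have hp0 : 0 < p := by linarith
  have hr : p * (1 - 2 / p) = p - 2 := by field_simp
  have hr0 : 0 ≤ 1 - 2 / p := by
    rw [sub_nonneg, div_le_one hp0]; exact hp
  have hr1 : 1 - 2 / p ≤ 1 := by
    have : 0 ≤ 2 / p := by positivity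
    linarith
  have h := (Real.concaveOn_rpow hr0 hr1).2 (Set.mem_Ici.2 (Real.rpow_nonneg ha p))
    (Set.mem_Ici.2 (Real.rpow_nonneg hb p)) (by norm_num : (0 : ℝ) ≤ 1 / 2)
    (by norm_num : (0 : ℝ) ≤ 1 / 2) (by norm_num)
  simp only [smul_eq_mul] at h
  rw [← Real.rpow_mul ha, ← Real.rpow_mul hb, hr] at h
  calc (a ^ (p - 2) + b ^ (p - 2)) / 2 = 1 / 2 * a ^ (p - 2) + 1 / 2 * b ^ (p - 2) := by ring
    _ ≤ _ := h
    _ = _ := by congr 1; ring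

/-- The two-point inequality, normalized so that the larger coordinate is `1`. -/
lemma two_point_rpow_mean_le_of_mem_Icc {p : ℝ} (hp : 2 ≤ p) {t : ℝ} (ht : t ∈ Set.Icc (0 : ℝ) 1) :
    (((1 + t) ^ p + (1 - t) ^ p) / 2) ^ (2 / p) ≤ 1 + (p - 1) * t ^ 2 := by
  have hp0 : 0 < p := by linarith
  set G : ℝ → ℝ := fun s => ((1 + s) ^ p + (1 - s) ^ p) / 2 with hG
  set G' : ℝ → ℝ := fun s => p * ((1 + s) ^ (p - 1) - (1 - s) ^ (p - 1)) / 2 with hG'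
  set G'' : ℝ → ℝ := fun s => p * (p - 1) * (((1 + s) ^ (p - 2) + (1 - s) ^ (p - 2)) / 2) with hG''
  have hadd (s : ℝ) : HasDerivAt (fun s : ℝ => 1 + s) 1 s := (hasDerivAt_id s).const_add 1
  have hsub (s : ℝ) : HasDerivAt (fun s : ℝ => 1 - s) (-1) s := (hasDerivAt_id s).const_sub 1
  have dG (s : ℝ) : HasDerivAt G (G' s) s := by
    have h := (((hadd s).rpow_const (p := p) (Or.inr (by linarith))).add
      ((hsub s).rpow_const (p := p) (Or.inr (by linarith)))).div_const 2
    exact h.congr_deriv (by simp only [hG']; ring)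
  have dG' (s : ℝ) : HasDerivAt G' (G'' s) s := by
    have h := ((((hadd s).rpow_const (p := p - 1) (Or.inr (by linarith))).sub
      ((hsub s).rpow_const (p := p - 1) (Or.inr (by linarith)))).const_mul p).div_const 2
    refine h.congr_deriv ?_
    simp only [hG'', show p - 1 - 1 = p - 2 by ring]
    ring
  have Gpos (s : ℝ) (hs : s ∈ Set.Icc (0 : ℝ) 1) : 0 < G s := by
    have h1 : 0 < (1 + s) ^ p := Real.rpow_pos_of_pos (by linarith [hs.1]) p
    have h2 : 0 ≤ (1 - s) ^ p := Real.rpow_nonneg (by linarith [hs.2]) p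
    simp only [hG]; linarith
  set D : ℝ → ℝ := fun s => 2 * (p - 1) * s - 2 / p * (G s ^ (2 / p - 1) * G' s) with hD
  set E : ℝ → ℝ := fun s => 1 + (p - 1) * s ^ 2 - G s ^ (2 / p) with hE
  have dD (s : ℝ) (hs : s ∈ Set.Icc (0 : ℝ) 1) : HasDerivAt D
      (2 * (p - 1) - 2 / p * (G' s * (2 / p - 1) * G s ^ (2 / p - 1 - 1) * G' s
        + G s ^ (2 / p - 1) * G'' s)) s := by
    have h := ((hasDerivAt_id s).const_mul (2 * (p - 1))).sub
      ((((dG s).rpow_const (p := 2 / p - 1) (Or.inl (Gpos s hs).ne')).mul (dG' s)).const_mul (2 / p))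
    exact h.congr_deriv (by ring)
  have dE (s : ℝ) (hs : s ∈ Set.Icc (0 : ℝ) 1) : HasDerivAt E (D s) s := by
    have h := (((hasDerivAt_pow 2 s).const_mul (p - 1)).const_add 1).sub
      ((dG s).rpow_const (p := 2 / p) (Or.inl (Gpos s hs).ne'))
    refine h.congr_deriv ?_
    simp only [hD]; push_cast; ring
  have D'_nonneg (s : ℝ) (hs : s ∈ Set.Icc (0 : ℝ) 1) :
      0 ≤ 2 * (p - 1) - 2 / p * (G' s * (2 / p - 1) * G s ^ (2 / p - 1 - 1) * G' s
        + G s ^ (2 / p - 1) * G'' s) := by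
    have h1 : G' s * (2 / p - 1) * G s ^ (2 / p - 1 - 1) * G' s ≤ 0 := by
      have h2 : 2 / p - 1 ≤ 0 := by rw [sub_nonpos, div_le_one hp0]; exact hp
      have h3 := Real.rpow_nonneg (Gpos s hs).le (2 / p - 1 - 1)
      nlinarith [mul_nonneg h3 (sq_nonneg (G' s))]
    have h4 : G s ^ (2 / p - 1) * G'' s ≤ p * (p - 1) := by
      have h5 := rpow_sub_two_mean_le hp (a := 1 + s) (b := 1 - s) (by linarith [hs.1])
        (by linarith [hs.2])
      have h6 : G s ^ (2 / p - 1) * G s ^ (1 - 2 / p) = 1 := by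
        rw [← Real.rpow_add (Gpos s hs)]; simp
      have hpp : 0 ≤ p * (p - 1) := mul_nonneg hp0.le (by linarith)
      calc G s ^ (2 / p - 1) * G'' s
          ≤ G s ^ (2 / p - 1) * (p * (p - 1) * G s ^ (1 - 2 / p)) :=
            mul_le_mul_of_nonneg_left (mul_le_mul_of_nonneg_left h5 hpp)
              (Real.rpow_nonneg (Gpos s hs).le _)
        _ = p * (p - 1) * (G s ^ (2 / p - 1) * G s ^ (1 - 2 / p)) := by ring
        _ = p * (p - 1) := by rw [h6, mul_one]
    have h7 := mul_le_mul_of_nonneg_left (add_le_add h1 h4) (by positivity : 0 ≤ 2 / p)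
    have h8 : 2 / p * (0 + p * (p - 1)) = 2 * (p - 1) := by field_simp; ring
    linarith
  have h0 : (0 : ℝ) ∈ Set.Icc (0 : ℝ) 1 := by simp
  have D_nonneg (s : ℝ) (hs : s ∈ Set.Icc (0 : ℝ) 1) : 0 ≤ D s := by
    have hm : MonotoneOn D (Set.Icc 0 1) := monotoneOn_of_hasDerivWithinAt_nonneg
      (convex_Icc 0 1) (fun u hu => (dD u hu).continuousAt.continuousWithinAt)
      (fun u hu => (dD u (interior_subset hu)).hasDerivWithinAt)
      (fun u hu => D'_nonneg u (interior_subset hu))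
    have hD0 : D 0 = 0 := by simp [hD, hG']
    simpa [hD0] using hm h0 hs hs.1
  have hm : MonotoneOn E (Set.Icc 0 1) := monotoneOn_of_hasDerivWithinAt_nonneg
    (convex_Icc 0 1) (fun u hu => (dE u hu).continuousAt.continuousWithinAt)
    (fun u hu => (dE u (interior_subset hu)).hasDerivWithinAt)
    (fun u hu => D_nonneg u (interior_subset hu))
  have hE0 : E 0 = 0 := by simp [hE, hG]
  have h := hm h0 ht ht.1
  rw [hE0] at h
  simp only [hE] at h
  linarith

lemma two_point_rpow_mean_le_of_le {p : ℝ} (hp : 2 ≤ p) {a b : ℝ} (hb : 0 ≤ b) (hab : b ≤ a) :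
    ((a + b) ^ p + (a - b) ^ p) / 2 ≤ (a ^ 2 + (p - 1) * b ^ 2) ^ (p / 2) := by
  have hp0 : 0 < p := by linarith
  rcases (hb.trans hab).eq_or_lt with rfl | ha
  · obtain rfl : b = 0 := le_antisymm hab hb
    simp [Real.zero_rpow hp0.ne', Real.zero_rpow (div_pos hp0 two_pos).ne']
  obtain ⟨t, rfl⟩ : ∃ t, b = a * t := ⟨b / a, by field_simp⟩
  have ht0 : 0 ≤ t := nonneg_of_mul_nonneg_right hb ha
  have ht1 : t ≤ 1 := by nlinarith
  have hm0 : 0 ≤ ((1 + t) ^ p + (1 - t) ^ p) / 2 := by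
    have h1 := Real.rpow_nonneg (by linarith : 0 ≤ 1 + t) p
    have h2 := Real.rpow_nonneg (by linarith : 0 ≤ 1 - t) p
    positivity
  have hle : ((1 + t) ^ p + (1 - t) ^ p) / 2 ≤ (1 + (p - 1) * t ^ 2) ^ (p / 2) := by
    have h := Real.rpow_le_rpow (Real.rpow_nonneg hm0 _)
      (two_point_rpow_mean_le_of_mem_Icc hp ⟨ht0, ht1⟩) (by positivity : 0 ≤ p / 2)
    rwa [← Real.rpow_mul hm0, show 2 / p * (p / 2) = 1 by field_simp, Real.rpow_one] at h
  have hsq : (a ^ 2) ^ (p / 2) = a ^ p := by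
    rw [← Real.rpow_natCast, ← Real.rpow_mul ha.le]; congr 1; push_cast; ring
  have hc : 0 ≤ 1 + (p - 1) * t ^ 2 := by nlinarith [sq_nonneg t]
  rw [show a + a * t = a * (1 + t) by ring, show a - a * t = a * (1 - t) by ring,
    show a ^ 2 + (p - 1) * (a * t) ^ 2 = a ^ 2 * (1 + (p - 1) * t ^ 2) by ring,
    Real.mul_rpow ha.le (by linarith), Real.mul_rpow ha.le (by linarith),
    Real.mul_rpow (sq_nonneg a) hc, hsq]
  calc _ = a ^ p * (((1 + t) ^ p + (1 - t) ^ p) / 2) := by ring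
    _ ≤ _ := mul_le_mul_of_nonneg_left hle (Real.rpow_nonneg ha.le p)

/-- The two-point (hypercontractive) inequality for `p ≥ 2`. -/
lemma two_point_rpow_mean_le {p : ℝ} (hp : 2 ≤ p) (a b : ℝ) :
    (|a + b| ^ p + |a - b| ^ p) / 2 ≤ (a ^ 2 + (p - 1) * b ^ 2) ^ (p / 2) := by
  have hp0 : 0 < p := by linarith
  have nonneg_case (a b : ℝ) (ha : 0 ≤ a) (hb : 0 ≤ b) :
      (|a + b| ^ p + |a - b| ^ p) / 2 ≤ (a ^ 2 + (p - 1) * b ^ 2) ^ (p / 2) := by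
    rw [abs_of_nonneg (add_nonneg ha hb)]
    rcases le_total b a with h | h
    · rw [abs_of_nonneg (sub_nonneg.2 h)]
      exact two_point_rpow_mean_le_of_le hp hb h
    · rw [abs_sub_comm, abs_of_nonneg (sub_nonneg.2 h), add_comm a b]
      refine (two_point_rpow_mean_le_of_le hp ha h).trans (Real.rpow_le_rpow ?_ ?_ (by positivity))
      · nlinarith [sq_nonneg a, sq_nonneg b]
      · nlinarith [mul_self_le_mul_self ha h]
  have h := nonneg_case |a| |b| (abs_nonneg a) (abs_nonneg b)
  rw [sq_abs, sq_abs] at h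
  refine le_of_eq_of_le ?_ h
  rcases abs_cases a with ⟨h1, -⟩ | ⟨h1, -⟩ <;> rcases abs_cases b with ⟨h2, -⟩ | ⟨h2, -⟩ <;>
    rw [h1, h2]
  · rw [sub_neg_eq_add, ← sub_eq_add_neg, add_comm]
  · rw [show -a + b = -(a - b) by ring, show -a - b = -(a + b) by ring, abs_neg, abs_neg, add_comm]
  · rw [show -a + -b = -(a + b) by ring, show -a - -b = -(a - b) by ring, abs_neg, abs_neg]

lemma lpNorm_nonneg (p : ℝ) (q : ℕ) (x : Fin q → ℝ) : 0 ≤ lpNorm p q x :=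
  Real.rpow_nonneg (Finset.sum_nonneg fun _ _ => Real.rpow_nonneg (abs_nonneg _) _) _

lemma lpNorm_rpow {p : ℝ} (hp : 0 < p) (q : ℕ) (x : Fin q → ℝ) :
    lpNorm p q x ^ p = ∑ i, |x i| ^ p := by
  rw [lpNorm, ← Real.rpow_mul (Finset.sum_nonneg fun _ _ => Real.rpow_nonneg (abs_nonneg _) _),
    one_div_mul_cancel hp.ne', Real.rpow_one]

/-- 2-uniform smoothness of the `ℓ_p` norm, in terms of `p`-th powers. -/
lemma lpNorm_rpow_mean_le {p : ℝ} (hp : 2 ≤ p) {q : ℕ} {x y : Fin q → ℝ}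
    (hx : lpNorm p q x = 1) (hy : lpNorm p q y = 1) (τ : ℝ) :
    (lpNorm p q (x + τ • y) ^ p + lpNorm p q (x - τ • y) ^ p) / 2
      ≤ (1 + (p - 1) * τ ^ 2) ^ (p / 2) := by
  have hp0 : 0 < p := by linarith
  have hpow (z : ℝ) : (z ^ 2) ^ (p / 2) = |z| ^ p := by
    rw [← sq_abs, ← Real.rpow_natCast, ← Real.rpow_mul (abs_nonneg z)]
    congr 1; push_cast; ring
  have hxs : ∑ i, |x i| ^ p = 1 := by rw [← lpNorm_rpow hp0, hx, Real.one_rpow]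
  have hys : ∑ i, |y i| ^ p = 1 := by rw [← lpNorm_rpow hp0, hy, Real.one_rpow]
  have hc : 0 ≤ (p - 1) * τ ^ 2 := mul_nonneg (by linarith) (sq_nonneg τ)
  have hmink := Real.Lp_add_le_of_nonneg (s := Finset.univ) (p := p / 2) (by linarith)
    (f := fun i => x i ^ 2) (g := fun i => (p - 1) * τ ^ 2 * y i ^ 2)
    (fun i _ => sq_nonneg _) (fun i _ => mul_nonneg hc (sq_nonneg _))
  have hsum : ∑ i, ((p - 1) * τ ^ 2 * y i ^ 2) ^ (p / 2) = ((p - 1) * τ ^ 2) ^ (p / 2) := by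
    simp_rw [Real.mul_rpow hc (sq_nonneg _), hpow]
    rw [← Finset.mul_sum, hys, mul_one]
  simp_rw [hsum, hpow, hxs] at hmink
  rw [Real.one_rpow, ← Real.rpow_mul hc, mul_one_div_cancel (by positivity), Real.rpow_one] at hmink
  have hS : 0 ≤ ∑ i, (x i ^ 2 + (p - 1) * τ ^ 2 * y i ^ 2) ^ (p / 2) :=
    Finset.sum_nonneg fun i _ =>
      Real.rpow_nonneg (add_nonneg (sq_nonneg _) (mul_nonneg hc (sq_nonneg _))) _
  have hmink' := Real.rpow_le_rpow (Real.rpow_nonneg hS _) hmink (by positivity : 0 ≤ p / 2)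
  rw [← Real.rpow_mul hS, one_div_mul_cancel (by positivity), Real.rpow_one] at hmink'
  refine le_trans ?_ hmink'
  rw [lpNorm_rpow hp0, lpNorm_rpow hp0, ← Finset.sum_add_distrib, Finset.sum_div]
  refine Finset.sum_le_sum fun i _ => ?_
  refine (two_point_rpow_mean_le hp (x i) (τ * y i)).trans_eq ?_
  congr 1; ring

/-- modulus-of-smoothness bound `ρ_p(τ) ≤ ((p-1)/2) τ²` for `p ≥ 2`. -/
theorem stmt_11 (p : ℝ) (hp : 2 ≤ p) (q : ℕ) (hq : 1 ≤ q)
    (x y : Fin q → ℝ) (hx : lpNorm p q x = 1) (hy : lpNorm p q y = 1)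
    (τ : ℝ) (hτ : 0 ≤ τ) :
    (lpNorm p q (x + τ • y) + lpNorm p q (x - τ • y)) / 2 - 1 ≤ ((p - 1) / 2) * τ ^ 2 := by
  have hp0 : 0 < p := by linarith
  set u := lpNorm p q (x + τ • y)
  set v := lpNorm p q (x - τ • y)
  have hu : 0 ≤ u := lpNorm_nonneg _ _ _
  have hv : 0 ≤ v := lpNorm_nonneg _ _ _
  have hc : 0 ≤ (p - 1) * τ ^ 2 := mul_nonneg (by linarith) (sq_nonneg τ)
  have hconv := (convexOn_rpow (by linarith : 1 ≤ p)).2 (Set.mem_Ici.2 hu) (Set.mem_Ici.2 hv)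
    (by norm_num : (0 : ℝ) ≤ 1 / 2) (by norm_num : (0 : ℝ) ≤ 1 / 2) (by norm_num)
  simp only [smul_eq_mul] at hconv
  have hbound : (1 + (p - 1) * τ ^ 2) ^ (p / 2) ≤ (1 + (p - 1) / 2 * τ ^ 2) ^ p := by
    have hsq : ((1 + (p - 1) / 2 * τ ^ 2) ^ 2) ^ (p / 2) = (1 + (p - 1) / 2 * τ ^ 2) ^ p := by
      rw [← Real.rpow_natCast, ← Real.rpow_mul (by linarith)]
      congr 1; push_cast; ring
    rw [← hsq]
    exact Real.rpow_le_rpow (by linarith) (by nlinarith [sq_nonneg ((p - 1) * τ ^ 2)])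
      (by positivity)
  have hmean : (u ^ p + v ^ p) / 2 ≤ (1 + (p - 1) * τ ^ 2) ^ (p / 2) :=
    lpNorm_rpow_mean_le hp hx hy τ
  have hle : 1 / 2 * u + 1 / 2 * v ≤ 1 + (p - 1) / 2 * τ ^ 2 :=
    (Real.rpow_le_rpow_iff (by positivity) (by linarith) hp0).1 (by linarith)
  linarith
end

section
/- Let p ∈ (1,∞) and q ≥ 2. Let A ⊆ ℝ^q be a compact convex set, let η > 0 and R > 0 be such that A contains a closed ℓ_p ball of radius η and is contained in a closed ℓ_p ball of radius R (so in particular A has nonempty interior), and let h > 0. Suppose y_1, …, y_N ∈ A and w_1, …, w_N ∈ ℝ^q satisfy, for each i: ‖w_i‖_{p*} = 1 (p* = p/(p−1)) and ⟨w_i, u − y_i⟩ ≥ 0 for all u ∈ A; and suppose that for every pair of distinct indices i < j, either ⟨w_i, w_j⟩ ≤ 0 (Euclidean inner product) or ⟨w_j, y_i − y_j⟩ ≥ h. Then there exists a constant C > 0, depending only on p, q, R, and η (and not on h or N), such that N ≤ C · max(1, h^{−(q−1)/2}); equivalently, if N ≥ 2C then h ≤ (C/N)^{−2/(q−1)}·(N/C)^{−2/(q−1)}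 = (N/C)^{−2/(q−1)}, i.e., h ≤ C^{2/(q−1)} · N^{−2/(q−1)}. -/
/-- Euclidean inner product on `Fin q → ℝ`. -/
def inner2 (q : ℕ) (x y : Fin q → ℝ) : ℝ := ∑ i, x i * y i

section

open MeasureTheory Metric

/-- A separated family on a sphere of the sup norm in `ℝ^q` has at most `O(δ^(-(q-1)))` members. -/
theorem card_mul_pow_le_of_separated_on_sphere {q N : ℕ} (hq : 1 ≤ q) {M δ : ℝ} (hM : 1 ≤ M)
    (hδ : 0 < δ) (hδ1 : δ ≤ 1) (c : Fin q → ℝ) (x : Fin N → Fin q → ℝ)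
    (hx : ∀ i, dist (x i) c = M) (hsep : ∀ i j, i < j → δ ≤ dist (x i) (x j)) :
    (N : ℝ) * δ ^ (q - 1) ≤ 2 * q * (2 * M + 2) ^ (q - 1) := by
  have hdisj : Pairwise (Function.onFun Disjoint fun i => ball (x i) (δ / 2)) := by
    intro i j hij
    apply ball_disjoint_ball
    rcases lt_or_gt_of_ne hij with h | h
    · linarith [hsep i j h]
    · linarith [hsep j i h, dist_comm (x i) (x j)]
  have hshell : (⋃ i, ball (x i) (δ / 2)) ⊆ ball c (M + δ / 2) \ ball c (M - δ / 2) := by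
    refine Set.iUnion_subset fun i z hz => ?_
    have hz' : dist z (x i) < δ / 2 := hz
    have h1 := dist_triangle z (x i) c
    have h2 := dist_triangle_left (x i) c z
    rw [hx i] at h1 h2
    simp only [Set.mem_sdiff, mem_ball, not_lt]
    constructor <;> linarith
  have hvol : ∀ (a : Fin q → ℝ) {r : ℝ}, 0 < r → volume.real (ball a r) = (2 * r) ^ q := by
    intro a r hr
    rw [measureReal_def, Real.volume_pi_ball a hr, ENNReal.toReal_ofReal (by positivity)]
    simp
  have hle : volume.real (⋃ i, ball (x i) (δ / 2)) ≤
      volume.real (ball c (M + δ / 2) \ ball c (M - δ / 2)) :=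
    measureReal_mono hshell
      (ne_top_of_le_ne_top measure_ball_lt_top.ne (measure_mono Set.sdiff_subset))
  rw [measureReal_iUnion_fintype hdisj (fun _ => measurableSet_ball)
      (fun _ => measure_ball_lt_top.ne),
    measureReal_sdiff (ball_subset_ball (by linarith)) measurableSet_ball
      measure_ball_lt_top.ne,
    hvol c (by linarith), hvol c (by linarith)] at hle
  simp only [hvol _ (half_pos hδ), Finset.sum_const, Finset.card_univ, Fintype.card_fin,
    nsmul_eq_mul] at hle
  have hpow := abs_pow_sub_pow_le (2 * (M + δ / 2)) (2 * (M - δ / 2)) q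
  rw [abs_of_nonneg (a := 2 * (M + δ / 2)) (by linarith),
    abs_of_nonneg (a := 2 * (M - δ / 2)) (by linarith), max_eq_left (by linarith)] at hpow
  have hdiff : |2 * (M + δ / 2) - 2 * (M - δ / 2)| = 2 * δ := by
    rw [abs_of_nonneg (by linarith)]; ring
  rw [hdiff] at hpow
  have hmono : (2 * (M + δ / 2)) ^ (q - 1) ≤ (2 * M + 2) ^ (q - 1) :=
    pow_le_pow_left₀ (by linarith) (by linarith) _
  have hδq : (2 * (δ / 2)) ^ q = δ ^ (q - 1) * δ := by
    rw [← pow_succ, Nat.sub_add_cancel hq]; congr 1; ring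
  rw [hδq] at hle
  have key : (N * δ ^ (q - 1)) * δ ≤ (2 * q * (2 * M + 2) ^ (q - 1)) * δ := by
    calc (N * δ ^ (q - 1)) * δ = N * (δ ^ (q - 1) * δ) := by ring
      _ ≤ 2 * δ * q * (2 * (M + δ / 2)) ^ (q - 1) := hle.trans ((le_abs_self _).trans hpow)
      _ ≤ 2 * δ * q * (2 * M + 2) ^ (q - 1) := by gcongr
      _ = _ := by ring
  exact le_of_mul_le_mul_right key hδ

end

theorem norm_le_lpNorm {p : ℝ} (hp : 0 < p) {q : ℕ} (x : Fin q → ℝ) : ‖x‖ ≤ lpNorm p q x := by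
  have hnn : ∀ i, 0 ≤ |x i| ^ p := fun i => Real.rpow_nonneg (abs_nonneg _) _
  refine (pi_norm_le_iff_of_nonneg (Real.rpow_nonneg (Finset.sum_nonneg fun i _ => hnn i) _)).2
    fun i => ?_
  calc ‖x i‖ = (|x i| ^ p) ^ (1 / p) := by
        rw [← Real.rpow_mul (abs_nonneg _), mul_one_div_cancel hp.ne', Real.rpow_one,
          Real.norm_eq_abs]
    _ ≤ _ := Real.rpow_le_rpow (hnn i)
        (Finset.single_le_sum (fun j _ => hnn j) (Finset.mem_univ i)) (by positivity)

theorem one_le_card_mul_norm_of_lpNorm_eq_one {p : ℝ} (hp : 1 ≤ p) {q : ℕ} {x : Fin q → ℝ}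
    (hx : lpNorm p q x = 1) : 1 ≤ q * ‖x‖ := by
  have hp0 : 0 < p := by linarith
  have hnn : 0 ≤ ∑ i, |x i| ^ p := Finset.sum_nonneg fun i _ => Real.rpow_nonneg (abs_nonneg _) _
  have hsum : ∑ i, |x i| ^ p = 1 := by
    refine (Real.rpow_left_inj hnn zero_le_one (one_div_pos.2 hp0).ne').1 ?_
    rw [Real.one_rpow]
    exact hx
  have hle : ∀ i, |x i| ≤ ‖x‖ := fun i => norm_le_pi_norm x i
  calc (1 : ℝ) = ∑ i, |x i| ^ p := hsum.symm
    _ ≤ ∑ _i : Fin q, ‖x‖ := Finset.sum_le_sum fun i _ =>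
        (Real.rpow_le_self_of_le_one (abs_nonneg _)
          ((hle i).trans ((norm_le_lpNorm hp0 x).trans hx.le)) hp).trans (hle i)
    _ = q * ‖x‖ := by simp

theorem inner2_self_nonneg {q : ℕ} (x : Fin q → ℝ) : 0 ≤ inner2 q x x :=
  Finset.sum_nonneg fun i _ => mul_self_nonneg (x i)

theorem inner2_self_le {q : ℕ} (x : Fin q → ℝ) : inner2 q x x ≤ q * ‖x‖ ^ 2 := by
  calc inner2 q x x ≤ ∑ _i : Fin q, ‖x‖ ^ 2 := Finset.sum_le_sum fun i _ => by
        rw [← sq, ← sq_abs]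
        exact pow_le_pow_left₀ (abs_nonneg _) (norm_le_pi_norm x i) 2
    _ = q * ‖x‖ ^ 2 := by simp

theorem norm_sq_le_inner2_self {q : ℕ} (x : Fin q → ℝ) : ‖x‖ ^ 2 ≤ inner2 q x x := by
  have h : ‖x‖ ≤ √(inner2 q x x) := by
    refine (pi_norm_le_iff_of_nonneg (Real.sqrt_nonneg _)).2 fun i => Real.abs_le_sqrt ?_
    rw [sq]
    exact Finset.single_le_sum (f := fun i => x i * x i) (fun j _ => mul_self_nonneg (x j))
      (Finset.mem_univ i)
  calc ‖x‖ ^ 2 ≤ √(inner2 q x x) ^ 2 := pow_le_pow_left₀ (norm_nonneg _) h 2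
    _ = inner2 q x x := Real.sq_sqrt (inner2_self_nonneg x)

theorem inner2_self_normal_translate {q : ℕ} (y y' w w' : Fin q → ℝ) (t t' : ℝ) :
    inner2 q ((y - t • w) - (y' - t' • w')) ((y - t • w) - (y' - t' • w')) =
      inner2 q (y - y') (y - y') + 2 * t * inner2 q w (y' - y) + 2 * t' * inner2 q w' (y - y')
        + inner2 q (t • w - t' • w') (t • w - t' • w') := by
  simp only [inner2, Finset.mul_sum, ← Finset.sum_add_distrib]
  refine Finset.sum_congr rfl fun i _ => ?_
  simp only [Pi.sub_apply, Pi.smul_apply, smul_eq_mul]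
  ring

theorem inner2_self_smul_sub_smul {q : ℕ} (w w' : Fin q → ℝ) (t t' : ℝ) :
    inner2 q (t • w - t' • w') (t • w - t' • w') =
      t ^ 2 * inner2 q w w + t' ^ 2 * inner2 q w' w' - 2 * (t * t') * inner2 q w w' := by
  simp only [inner2, Finset.mul_sum, ← Finset.sum_add_distrib, ← Finset.sum_sub_distrib]
  refine Finset.sum_congr rfl fun i _ => ?_
  simp only [Pi.sub_apply, Pi.smul_apply, smul_eq_mul]
  ring

/-- A ray starting near `c` meets every large sphere centred at `c` at a parameter `t ≥ 1`. -/
theorem exists_dist_sub_smul_eq {E : Type*} [NormedAddCommGroup E] [NormedSpace ℝ E]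
    {y w c : E} {R : ℝ} (hy : ‖y - c‖ ≤ R) (hw : w ≠ 0) (hw1 : ‖w‖ ≤ 1) :
    ∃ t : ℝ, 1 ≤ t ∧ dist (y - t • w) c = R + 1 := by
  have hw0 : 0 < ‖w‖ := norm_pos_iff.2 hw
  have hR : 0 ≤ R := (norm_nonneg _).trans hy
  set T : ℝ := (2 * R + 1) / ‖w‖ with hT
  have hTw : T * ‖w‖ = 2 * R + 1 := div_mul_cancel₀ _ hw0.ne'
  have hT1 : 1 ≤ T := by rw [hT, one_le_div hw0]; linarith
  have hcont : ContinuousOn (fun t : ℝ => dist (y - t • w) c) (Set.Icc 1 T) := by fun_prop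
  have hmem : R + 1 ∈ Set.Icc (dist (y - (1 : ℝ) • w) c) (dist (y - T • w) c) := by
    constructor
    · rw [dist_eq_norm, one_smul, sub_right_comm]
      linarith [norm_sub_le (y - c) w]
    · rw [dist_eq_norm, sub_right_comm]
      have h := norm_sub_norm_le (T • w) (y - c)
      rw [norm_smul, Real.norm_of_nonneg (by linarith), hTw,
        norm_sub_rev (T • w)] at h
      linarith
  obtain ⟨t, ht, hteq⟩ := intermediate_value_Icc hT1 hcont hmem
  exact ⟨t, ht.1, hteq⟩

theorem one_le_min_sqrt_pow_mul_max {h : ℝ} (hh : 0 < h) (n : ℕ) :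
    1 ≤ min 1 √h ^ n * max 1 (h ^ (-((n : ℝ) / 2))) := by
  rcases le_total 1 h with h1 | h1
  · rw [min_eq_left (Real.one_le_sqrt.2 h1), one_pow, one_mul]
    exact le_max_left _ _
  · rw [min_eq_right (Real.sqrt_le_one.2 h1)]
    calc (1 : ℝ) = √h ^ n * h ^ (-((n : ℝ) / 2)) := by
          rw [Real.sqrt_eq_rpow, ← Real.rpow_mul_natCast hh.le, ← Real.rpow_add hh,
            show 1 / 2 * (n : ℝ) + -((n : ℝ) / 2) = 0 by ring, Real.rpow_zero]
      _ ≤ _ := by gcongr; exact le_max_right _ _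

/-- counting bound for support points with pairwise conditions.
There is a constant `C > 0` depending only on `p`, `q`, `R`, `η` such that any
family of `N` support points/unit dual normals of a compact convex body
(containing an ℓ_p ball of radius `η` and contained in one of radius `R`),
in which every pair of distinct indices has either non-positively correlated
normals or hyperplane distance at least `h`, satisfies
`N ≤ C · max(1, h^(-(q-1)/2))`. -/
theorem stmt_17 (p : ℝ) (hp : 1 < p) (q : ℕ) (hq : 2 ≤ q)
    (R η : ℝ) (hR : 0 < R) (hη : 0 < η) :
    ∃ C : ℝ, 0 < C ∧
      ∀ (A : Set (Fin q → ℝ)), IsCompact A → Convex ℝ A →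
      (∃ c : Fin q → ℝ, {x : Fin q → ℝ | lpNorm p q (x - c) ≤ η} ⊆ A) →
      (∃ c' : Fin q → ℝ, ∀ a ∈ A, lpNorm p q (a - c') ≤ R) →
      ∀ (h : ℝ), 0 < h →
      ∀ (N : ℕ) (y w : Fin N → (Fin q → ℝ)),
      (∀ i, y i ∈ A) →
      (∀ i, lpNorm (p / (p - 1)) q (w i) = 1) →
      (∀ i, ∀ u ∈ A, 0 ≤ inner2 q (w i) (u - y i)) →
      (∀ i j : Fin N, i < j →
        inner2 q (w i) (w j) ≤ 0 ∨ h ≤ inner2 q (w j) (y i - y j)) →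
      (N : ℝ) ≤ C * max 1 (h ^ (-(((q : ℝ) - 1) / 2))) := by
  have hq1 : 1 ≤ q := by omega
  have hqR : (2 : ℝ) ≤ q := by exact_mod_cast hq
  have hq0 : (0 : ℝ) < q := by linarith
  have hp' : 1 ≤ p / (p - 1) := by rw [one_le_div (by linarith)]; linarith
  refine ⟨2 * q * (2 * (R + 1) + 2) ^ (q - 1) * ((q : ℝ) ^ 2) ^ (q - 1), by positivity, ?_⟩
  rintro A - - - ⟨c, hc⟩ h hh N y w hy hw hsupp hpair
  have hwnorm : ∀ i, 1 / (q : ℝ) ≤ ‖w i‖ := fun i => by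
    rw [div_le_iff₀' hq0]
    exact one_le_card_mul_norm_of_lpNorm_eq_one hp' (hw i)
  have hwself : ∀ i, 1 / (q : ℝ) ^ 2 ≤ inner2 q (w i) (w i) := fun i => by
    refine le_trans ?_ (norm_sq_le_inner2_self (w i))
    rw [← one_div_pow]
    exact pow_le_pow_left₀ (by positivity) (hwnorm i) 2
  have hray : ∀ i, ∃ t : ℝ, 1 ≤ t ∧ dist (y i - t • w i) c = R + 1 := fun i =>
    exists_dist_sub_smul_eq ((norm_le_lpNorm (by linarith) _).trans (hc _ (hy i)))
      (norm_pos_iff.1 (lt_of_lt_of_le (by positivity) (hwnorm i)))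
      ((norm_le_lpNorm (by linarith) _).trans (hw i).le)
  choose t ht hdist using hray
  set m : ℝ := min 1 √h with hm
  have hm0 : 0 < m := lt_min one_pos (Real.sqrt_pos.2 hh)
  have hm1 : m ≤ 1 := min_le_left _ _
  have hmh : m ^ 2 ≤ h := by
    calc m ^ 2 ≤ √h ^ 2 := pow_le_pow_left₀ hm0.le (min_le_right _ _) 2
      _ = h := Real.sq_sqrt hh.le
  have hq21 : (1 : ℝ) ≤ (q : ℝ) ^ 2 := one_le_pow₀ (by linarith)
  have hsep : ∀ i j, i < j → m / (q : ℝ) ^ 2 ≤ dist (y i - t i • w i) (y j - t j • w j) := by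
    intro i j hij
    have hlower : m ^ 2 / (q : ℝ) ^ 2 ≤
        inner2 q ((y i - t i • w i) - (y j - t j • w j))
          ((y i - t i • w i) - (y j - t j • w j)) := by
      rw [inner2_self_normal_translate]
      have hyy := inner2_self_nonneg (y i - y j)
      have hi : 0 ≤ 2 * t i * inner2 q (w i) (y j - y i) :=
        mul_nonneg (by linarith [ht i]) (hsupp i _ (hy j))
      rcases hpair i j hij with hneg | hfar
      · have hj : 0 ≤ 2 * t j * inner2 q (w j) (y i - y j) :=
          mul_nonneg (by linarith [ht j]) (hsupp j _ (hy i))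
        have htt : 0 ≤ t i * t j := mul_nonneg (by linarith [ht i]) (by linarith [ht j])
        have hcross := mul_nonneg htt (neg_nonneg.2 hneg)
        have h1 : inner2 q (w i) (w i) ≤ t i ^ 2 * inner2 q (w i) (w i) :=
          le_mul_of_one_le_left (inner2_self_nonneg _) (one_le_pow₀ (ht i))
        have h2 : 0 ≤ t j ^ 2 * inner2 q (w j) (w j) :=
          mul_nonneg (sq_nonneg _) (inner2_self_nonneg _)
        have h3 : m ^ 2 / (q : ℝ) ^ 2 ≤ 1 / (q : ℝ) ^ 2 := by
          gcongr
          exact pow_le_one₀ hm0.le hm1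
        rw [inner2_self_smul_sub_smul]
        linarith [hwself i]
      · have hj : h ≤ t j * inner2 q (w j) (y i - y j) :=
          hfar.trans (le_mul_of_one_le_left (hsupp j _ (hy i)) (ht j))
        have h3 : m ^ 2 / (q : ℝ) ^ 2 ≤ m ^ 2 := div_le_self (sq_nonneg _) hq21
        linarith [inner2_self_nonneg (t i • w i - t j • w j)]
    rw [dist_eq_norm]
    refine le_of_sq_le_sq ?_ (norm_nonneg _)
    have hupper := hlower.trans (inner2_self_le _)
    refine le_of_mul_le_mul_left (le_trans ?_ hupper) hq0
    calc (q : ℝ) * (m / (q : ℝ) ^ 2) ^ 2 = m ^ 2 / (q : ℝ) ^ 2 / q := by field_simp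
      _ ≤ m ^ 2 / (q : ℝ) ^ 2 := div_le_self (by positivity) (by linarith)
  have hcount := card_mul_pow_le_of_separated_on_sphere hq1 (by linarith : 1 ≤ R + 1)
    (by positivity) ((div_le_self hm0.le hq21).trans hm1) c _ hdist hsep
  rw [div_pow, ← mul_div_assoc, div_le_iff₀ (by positivity)] at hcount
  have hfinal := one_le_min_sqrt_pow_mul_max hh (q - 1)
  rw [Nat.cast_sub hq1, Nat.cast_one, ← hm] at hfinal
  calc (N : ℝ) ≤ N * (m ^ (q - 1) * max 1 (h ^ (-(((q : ℝ) - 1) / 2)))) :=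
        le_mul_of_one_le_right (Nat.cast_nonneg _) hfinal
    _ = N * m ^ (q - 1) * max 1 (h ^ (-(((q : ℝ) - 1) / 2))) := by ring
    _ ≤ _ := by gcongr
end
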